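/- There exists an absolute constant γ such that for every positive integer k and every q with 0 < q < 1, the random variable X ~ Binomial(k, q) satisfies sup_{i ∈ ℕ∪{0}} | √(Var X)·P(X = i) − (1/√(2π))·exp(−(i − E[X])² / (2·Var X)) | < γ / √(Var X). -/

import Mathlib

open MeasureTheory ProbabilityTheory
open scoped ENNReal

/-- The probability that a `Binomial(k, q)` random variable equals `i`. -/
noncomputable def binomProb (k : ℕ) (q : ℝ) (i : ℕ) : ℝ :=
  (k.choose i : ℝ) * q ^ i * (1 - q) ^ (k - i)

open Complex in
/-- The characteristic function of `B - q`, where `B` is a Bernoulli variable of parameter `q`. -/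
noncomputable def centeredBernoulliCharFun (q t : ℝ) : ℂ :=
  q * cexp (((1 - q) * t : ℝ) * I) + (1 - q : ℝ) * cexp ((-(q * t) : ℝ) * I)

theorem continuous_centeredBernoulliCharFun (q : ℝ) :
    Continuous (centeredBernoulliCharFun q) := by
  unfold centeredBernoulliCharFun
  fun_prop

theorem normSq_centeredBernoulliCharFun (q t : ℝ) :
    ‖centeredBernoulliCharFun q t‖ ^ 2 = 1 - 2 * (q * (1 - q)) * (1 - Real.cos t) := by
  have hcos : Real.cos t = Real.cos ((1 - q) * t) * Real.cos (-(q * t)) +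
      Real.sin ((1 - q) * t) * Real.sin (-(q * t)) := by
    rw [← Real.cos_sub]
    congr 1
    ring
  rw [← Complex.normSq_eq_norm_sq, Complex.normSq_apply, hcos]
  simp only [centeredBernoulliCharFun, Complex.add_re, Complex.add_im, Complex.re_ofReal_mul,
    Complex.im_ofReal_mul, Complex.exp_ofReal_mul_I_re, Complex.exp_ofReal_mul_I_im]
  linear_combination q ^ 2 * Real.sin_sq_add_cos_sq ((1 - q) * t) +
    (1 - q) ^ 2 * Real.sin_sq_add_cos_sq (-(q * t))

theorem norm_centeredBernoulliCharFun_le {q t : ℝ} (hq : 0 ≤ q) (hq1 : q ≤ 1)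
    (ht : |t| ≤ Real.pi) :
    ‖centeredBernoulliCharFun q t‖ ≤
      Real.exp (-(2 / Real.pi ^ 2 * (q * (1 - q)) * t ^ 2)) := by
  have hv : 0 ≤ q * (1 - q) := mul_nonneg hq (by linarith)
  have hcos := Real.cos_le_one_sub_mul_cos_sq ht
  refine le_of_sq_le_sq ?_ (Real.exp_pos _).le
  rw [normSq_centeredBernoulliCharFun, ← Real.exp_nat_mul]
  refine le_trans ?_ (Real.add_one_le_exp _)
  push_cast
  nlinarith [mul_le_mul_of_nonneg_left hcos hv]

theorem norm_exp_mul_I_sub_quadratic_le {x : ℝ} (hx : |x| ≤ Real.pi) :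
    ‖Complex.exp (x * Complex.I) - (1 + x * Complex.I - x ^ 2 / 2)‖ ≤
      |x| ^ 3 * Real.exp Real.pi := by
  have h := Complex.norm_exp_sub_sum_le_norm_mul_exp (x * Complex.I) 3
  have hsum : ∑ m ∈ Finset.range 3, ((x : ℂ) * Complex.I) ^ m / (m.factorial : ℂ) =
      1 + x * Complex.I - x ^ 2 / 2 := by
    simp [Finset.sum_range_succ, mul_pow]
    ring
  have hnorm : ‖(x : ℂ) * Complex.I‖ = |x| := by simp
  rw [hsum, hnorm] at h
  exact h.trans (by gcongr)

theorem abs_exp_neg_sub_one_sub_le {y : ℝ} (hy : 0 ≤ y) :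
    |Real.exp (-y) - (1 - y)| ≤ y ^ 2 := by
  have h1 : 1 - y ≤ Real.exp (-y) := Real.one_sub_le_exp_neg y
  have h2 : Real.exp (-y) * (1 + y) ≤ 1 := by
    calc Real.exp (-y) * (1 + y) ≤ Real.exp (-y) * Real.exp y := by
          gcongr
          linarith [Real.add_one_le_exp y]
      _ = 1 := by rw [← Real.exp_add]; simp
  rw [abs_of_nonneg (by linarith)]
  have : Real.exp (-y) ≤ 1 := Real.exp_le_one_iff.mpr (by linarith)
  nlinarith

theorem norm_centeredBernoulliCharFun_sub_gaussian_le {q t : ℝ} (hq : 0 ≤ q) (hq1 : q ≤ 1)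
    (ht : |t| ≤ Real.pi) :
    ‖centeredBernoulliCharFun q t - (Real.exp (-(q * (1 - q) * t ^ 2 / 2)) : ℝ)‖ ≤
      (Real.exp Real.pi + 1) * (q * (1 - q)) * |t| ^ 3 := by
  have hp : 0 ≤ 1 - q := by linarith
  have hv : 0 ≤ q * (1 - q) := mul_nonneg hq hp
  have hv4 : q * (1 - q) ≤ 1 / 4 := by nlinarith [sq_nonneg (q - 1 / 2)]
  have ha : |(1 - q) * t| = (1 - q) * |t| := by rw [abs_mul, abs_of_nonneg hp]
  have hb : |-(q * t)| = q * |t| := by rw [abs_neg, abs_mul, abs_of_nonneg hq]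
  have h1 := norm_exp_mul_I_sub_quadratic_le (x := (1 - q) * t)
    (by rw [ha]; nlinarith [abs_nonneg t])
  have h2 := norm_exp_mul_I_sub_quadratic_le (x := -(q * t))
    (by rw [hb]; nlinarith [abs_nonneg t])
  have h3 := abs_exp_neg_sub_one_sub_le (y := q * (1 - q) * t ^ 2 / 2) (by positivity)
  rw [ha] at h1
  rw [hb] at h2
  rw [← Real.norm_eq_abs, ← Complex.norm_real] at h3
  set A := Complex.exp (((1 - q) * t : ℝ) * Complex.I) -
    (1 + ((1 - q) * t : ℝ) * Complex.I - ((1 - q) * t : ℝ) ^ 2 / 2) with hA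
  set B := Complex.exp ((-(q * t) : ℝ) * Complex.I) -
    (1 + (-(q * t) : ℝ) * Complex.I - (-(q * t) : ℝ) ^ 2 / 2) with hB
  set D := Real.exp (-(q * (1 - q) * t ^ 2 / 2)) - (1 - q * (1 - q) * t ^ 2 / 2) with hD
  have hsplit : centeredBernoulliCharFun q t - (Real.exp (-(q * (1 - q) * t ^ 2 / 2)) : ℝ) =
      (q : ℂ) * A + (1 - q : ℝ) * B - (D : ℝ) := by
    rw [hA, hB, hD, centeredBernoulliCharFun]
    push_cast
    ring
  have hnq : ‖(q : ℂ)‖ = q := by simp [abs_of_nonneg hq]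
  have hnp : ‖((1 - q : ℝ) : ℂ)‖ = 1 - q := by
    rw [Complex.norm_real, Real.norm_eq_abs, abs_of_nonneg hp]
  have hD' : ‖(D : ℂ)‖ ≤ q * (1 - q) * |t| ^ 3 := by
    refine h3.trans ?_
    have ht4 : |t| ≤ 4 := ht.trans Real.pi_le_four
    calc (q * (1 - q) * t ^ 2 / 2) ^ 2
        = q * (1 - q) * |t| ^ 3 * (q * (1 - q) * |t| / 4) := by
          rw [← sq_abs t]; ring
      _ ≤ q * (1 - q) * |t| ^ 3 * 1 := by
          gcongr
          nlinarith [abs_nonneg t]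
      _ = _ := mul_one _
  rw [hsplit]
  calc ‖(q : ℂ) * A + (1 - q : ℝ) * B - (D : ℝ)‖
      ≤ ‖(q : ℂ) * A‖ + ‖((1 - q : ℝ) : ℂ) * B‖ + ‖(D : ℂ)‖ :=
        (norm_sub_le _ _).trans (by gcongr; exact norm_add_le _ _)
    _ ≤ q * (((1 - q) * |t|) ^ 3 * Real.exp Real.pi) +
          (1 - q) * ((q * |t|) ^ 3 * Real.exp Real.pi) + q * (1 - q) * |t| ^ 3 := by
        rw [norm_mul, norm_mul, hnq, hnp]
        gcongr
    _ = (((1 - q) ^ 2 + q ^ 2) * Real.exp Real.pi + 1) * (q * (1 - q)) * |t| ^ 3 := by ring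
    _ ≤ (1 * Real.exp Real.pi + 1) * (q * (1 - q)) * |t| ^ 3 := by
        gcongr
        nlinarith
    _ = _ := by ring

theorem norm_pow_sub_pow_le_mul_of_norm_le {z w : ℂ} {M : ℝ} (hz : ‖z‖ ≤ M) (hw : ‖w‖ ≤ M)
    (n : ℕ) : ‖z ^ n - w ^ n‖ ≤ n * M ^ (n - 1) * ‖z - w‖ := by
  have hM : 0 ≤ M := (norm_nonneg z).trans hz
  rw [← geom_sum₂_mul, norm_mul]
  gcongr
  refine (norm_sum_le _ _).trans ?_
  calc ∑ j ∈ Finset.range n, ‖z ^ j * w ^ (n - 1 - j)‖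
      ≤ ∑ _j ∈ Finset.range n, M ^ (n - 1) := by
        refine Finset.sum_le_sum fun j hj => ?_
        have hj' : j + (n - 1 - j) = n - 1 := by
          have := Finset.mem_range.mp hj
          omega
        rw [norm_mul, norm_pow, norm_pow, ← hj', pow_add, hj']
        gcongr
    _ = n * M ^ (n - 1) := by simp

theorem norm_centeredBernoulliCharFun_pow_sub_gaussian_le {q t : ℝ} (hq : 0 ≤ q) (hq1 : q ≤ 1)
    (ht : |t| ≤ Real.pi) {k : ℕ} (hk : 1 ≤ k) :
    ‖centeredBernoulliCharFun q t ^ k -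
        (Real.exp (-(k * q * (1 - q) / 2 * t ^ 2)) : ℝ)‖ ≤
      (Real.exp Real.pi + 1) * Real.exp 1 * (k * q * (1 - q)) *
        (|t| ^ 3 * Real.exp (-(2 / Real.pi ^ 2 * (k * q * (1 - q))) * t ^ 2)) := by
  have hp : 0 ≤ 1 - q := by linarith
  have hv : 0 ≤ q * (1 - q) := mul_nonneg hq hp
  have hv4 : q * (1 - q) ≤ 1 / 4 := by nlinarith [sq_nonneg (q - 1 / 2)]
  have hpi : (2 : ℝ) ≤ Real.pi := Real.two_le_pi
  have hc : 2 / Real.pi ^ 2 ≤ 1 / 2 := by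
    rw [div_le_div_iff₀ (by positivity) (by norm_num)]
    nlinarith
  have htt : t ^ 2 ≤ Real.pi ^ 2 := by
    rw [← sq_abs t]
    gcongr
  have hg : ‖((Real.exp (-(q * (1 - q) * t ^ 2 / 2)) : ℝ) : ℂ)‖ ≤
      Real.exp (-(2 / Real.pi ^ 2 * (q * (1 - q)) * t ^ 2)) := by
    rw [Complex.norm_real, Real.norm_eq_abs, abs_of_pos (Real.exp_pos _)]
    refine Real.exp_le_exp.mpr ?_
    have := mul_le_mul_of_nonneg_right hc (mul_nonneg hv (sq_nonneg t))
    linarith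
  have hpow : (Real.exp (-(k * q * (1 - q) / 2 * t ^ 2)) : ℝ) =
      Real.exp (-(q * (1 - q) * t ^ 2 / 2)) ^ k := by
    rw [← Real.exp_nat_mul]
    congr 1
    ring
  have hM : Real.exp (-(2 / Real.pi ^ 2 * (q * (1 - q)) * t ^ 2)) ^ (k - 1) ≤
      Real.exp 1 * Real.exp (-(2 / Real.pi ^ 2 * (k * q * (1 - q))) * t ^ 2) := by
    rw [← Real.exp_nat_mul, ← Real.exp_add, Nat.cast_sub hk]
    refine Real.exp_le_exp.mpr ?_
    have h1 : 2 / Real.pi ^ 2 * (q * (1 - q)) * t ^ 2 ≤ 1 := by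
      calc 2 / Real.pi ^ 2 * (q * (1 - q)) * t ^ 2
          ≤ 2 / Real.pi ^ 2 * (1 / 4) * Real.pi ^ 2 := by gcongr
        _ ≤ 1 := by field_simp; norm_num
    push_cast
    linarith
  rw [hpow, Complex.ofReal_pow]
  refine (norm_pow_sub_pow_le_mul_of_norm_le (norm_centeredBernoulliCharFun_le hq hq1 ht) hg
    k).trans ?_
  calc _ ≤ k * (Real.exp 1 * Real.exp (-(2 / Real.pi ^ 2 * (k * q * (1 - q))) * t ^ 2)) *
        ((Real.exp Real.pi + 1) * (q * (1 - q)) * |t| ^ 3) := by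
        gcongr
        exact norm_centeredBernoulliCharFun_sub_gaussian_le hq hq1 ht
    _ = _ := by ring

theorem integrable_abs_cube_mul_exp_neg_mul_sq {b : ℝ} (hb : 0 < b) :
    Integrable fun t : ℝ => |t| ^ 3 * Real.exp (-b * t ^ 2) := by
  have h := (integrable_rpow_mul_exp_neg_mul_sq hb (s := 3) (by norm_num)).norm
  refine h.congr (Filter.Eventually.of_forall fun t => ?_)
  have : t ^ (3 : ℝ) = t ^ 3 := by exact_mod_cast Real.rpow_natCast t 3
  simp [this]

theorem integral_abs_cube_mul_exp_neg_mul_sq {b : ℝ} (hb : 0 < b) :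
    ∫ t : ℝ, |t| ^ 3 * Real.exp (-b * t ^ 2) = (b ^ 2)⁻¹ := by
  have h := integral_rpow_mul_exp_neg_mul_rpow (p := 2) (q := 3) (b := b) (by norm_num)
    (by norm_num) hb
  have h2 : -((3 : ℝ) + 1) / 2 = -((2 : ℕ) : ℝ) := by norm_num
  have h3 : ((3 : ℝ) + 1) / 2 = 2 := by norm_num
  rw [h2, h3, Real.rpow_neg hb.le, Real.rpow_natCast, Real.Gamma_two] at h
  have habs := integral_comp_abs (f := fun t : ℝ => t ^ 3 * Real.exp (-b * t ^ 2))
  simp only [sq_abs] at habs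
  have hcast : ∀ t : ℝ, t ^ 3 * Real.exp (-b * t ^ 2) =
      t ^ (3 : ℝ) * Real.exp (-b * t ^ (2 : ℝ)) := fun t => by
    rw [← Real.rpow_natCast t 3, ← Real.rpow_natCast t 2]
    norm_num
  rw [habs]
  simp only [hcast]
  rw [h]
  ring

theorem intervalIntegral_exp_int_mul_I (n : ℤ) :
    ∫ t in (-Real.pi)..Real.pi, Complex.exp (n * Complex.I * t) =
      if n = 0 then 2 * (Real.pi : ℂ) else 0 := by
  split_ifs with hn
  · subst hn
    simp
    ring
  · have hc : (n : ℂ) * Complex.I ≠ 0 :=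
      mul_ne_zero (Int.cast_ne_zero.mpr hn) Complex.I_ne_zero
    rw [integral_exp_mul_complex hc, div_eq_zero_iff]
    left
    rw [sub_eq_zero, Complex.exp_eq_exp_iff_exists_int]
    refine ⟨n, ?_⟩
    push_cast
    ring

open Complex in
theorem intervalIntegral_centeredBernoulliCharFun_pow (k : ℕ) (q : ℝ) (i : ℕ) :
    ∫ t in (-Real.pi)..Real.pi,
        cexp (I * (-((i : ℝ) - k * q) : ℝ) * t) * centeredBernoulliCharFun q t ^ k =
      2 * Real.pi * binomProb k q i := by
  have hexpand : ∀ t : ℝ,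
      cexp (I * (-((i : ℝ) - k * q) : ℝ) * t) * centeredBernoulliCharFun q t ^ k =
        ∑ m ∈ Finset.range (k + 1), (binomProb k q m : ℂ) *
          cexp (((m : ℤ) - (i : ℤ) : ℤ) * I * t) := by
    intro t
    rw [centeredBernoulliCharFun, add_pow, Finset.mul_sum]
    refine Finset.sum_congr rfl fun m hm => ?_
    have hmk : m ≤ k := Nat.lt_succ_iff.mp (Finset.mem_range.mp hm)
    have hphase : cexp (I * (-((i : ℝ) - k * q) : ℝ) * t) *
        (cexp (((1 - q) * t : ℝ) * I) ^ m * cexp ((-(q * t) : ℝ) * I) ^ (k - m)) =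
          cexp (((m : ℤ) - (i : ℤ) : ℤ) * I * t) := by
      rw [← Complex.exp_nat_mul, ← Complex.exp_nat_mul, ← Complex.exp_add, ← Complex.exp_add,
        Nat.cast_sub hmk]
      congr 1
      push_cast
      ring
    rw [← hphase, binomProb, mul_pow, mul_pow]
    push_cast
    ring
  simp only [hexpand]
  rw [intervalIntegral.integral_finsetSum
    fun m _ => (Continuous.intervalIntegrable (by fun_prop) _ _)]
  simp only [intervalIntegral.integral_const_mul, intervalIntegral_exp_int_mul_I, sub_eq_zero,
    Nat.cast_inj, mul_ite, mul_zero, Finset.sum_ite_eq', Finset.mem_range]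
  split_ifs with hi
  · ring
  · simp [binomProb, Nat.choose_eq_zero_of_lt (by omega : k < i)]

open Complex in
theorem integral_exp_mul_gaussian {S : ℝ} (hS : 0 < S) (x : ℝ) :
    ∫ t : ℝ, cexp (I * (-x : ℝ) * t) * (Real.exp (-(S / 2 * t ^ 2)) : ℝ) =
      (Real.sqrt (2 * Real.pi) / Real.sqrt S * Real.exp (-x ^ 2 / (2 * S)) : ℝ) := by
  have h := fourierIntegral_gaussian (b := ((S / 2 : ℝ) : ℂ))
    (by rw [Complex.ofReal_re]; positivity) ((-x : ℝ) : ℂ)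
  have hcoef : ((Real.pi : ℂ) / ((S / 2 : ℝ) : ℂ)) ^ (1 / 2 : ℂ) =
      (Real.sqrt (2 * Real.pi) / Real.sqrt S : ℝ) := by
    rw [← Real.sqrt_div (by positivity), Real.sqrt_eq_rpow, Complex.ofReal_cpow (by positivity)]
    congr 1
    · push_cast
      field_simp
    · norm_num
  rw [hcoef] at h
  rw [Complex.ofReal_mul, Complex.ofReal_exp]
  convert h using 3
  · congr 1
    push_cast
    ring_nf
  · push_cast
    congr 1
    field_simp
    ring

theorem exp_neg_le_inv {y : ℝ} (hy : 0 < y) : Real.exp (-y) ≤ y⁻¹ := by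
  rw [Real.exp_neg]
  exact inv_anti₀ hy (by linarith [Real.add_one_le_exp y])

open Complex in
theorem norm_truncated_charFun_sub_gaussian_le {q : ℝ} (hq : 0 < q) (hq1 : q < 1) {k : ℕ}
    (hk : 1 ≤ k) (x t : ℝ) :
    ‖(Set.Ioc (-Real.pi) Real.pi).indicator
          (fun t : ℝ => cexp (I * (-x : ℝ) * t) * centeredBernoulliCharFun q t ^ k) t -
        cexp (I * (-x : ℝ) * t) * (Real.exp (-(k * q * (1 - q) / 2 * t ^ 2)) : ℝ)‖ ≤
      (Real.exp Real.pi + 1) * Real.exp 1 * (k * q * (1 - q)) *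
          (|t| ^ 3 * Real.exp (-(2 / Real.pi ^ 2 * (k * q * (1 - q))) * t ^ 2)) +
        4 / (k * q * (1 - q)) * (1 + t ^ 2)⁻¹ := by
  have hp : 0 < 1 - q := by linarith
  have hk0 : (0 : ℝ) < k := by exact_mod_cast hk
  have hS : 0 < k * q * (1 - q) := by positivity
  have hphase : ‖cexp (I * (-x : ℝ) * t)‖ = 1 := by
    rw [show I * ((-x : ℝ) : ℂ) * t = ((-x * t : ℝ) : ℂ) * I by push_cast; ring,
      Complex.norm_exp_ofReal_mul_I]
  by_cases ht : t ∈ Set.Ioc (-Real.pi) Real.pi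
  · rw [Set.indicator_of_mem ht, ← mul_sub, norm_mul, hphase, one_mul]
    refine (norm_centeredBernoulliCharFun_pow_sub_gaussian_le hq.le hq1.le
      (abs_le.mpr ⟨ht.1.le, ht.2⟩) hk).trans ?_
    exact le_add_of_nonneg_right (by positivity)
  · have ht1 : 1 ≤ t ^ 2 := by
      have hpi := Real.two_le_pi
      rcases le_or_gt t (-Real.pi) with h | h
      · nlinarith
      · have : Real.pi < t := not_le.mp fun h' => ht ⟨h, h'⟩
        nlinarith
    rw [Set.indicator_of_notMem ht, zero_sub, norm_neg, norm_mul, hphase, one_mul,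
      Complex.norm_real, Real.norm_eq_abs, abs_of_pos (Real.exp_pos _)]
    refine le_trans ?_ (le_add_of_nonneg_left (by positivity))
    refine (exp_neg_le_inv (by positivity)).trans ?_
    rw [← div_eq_mul_inv, div_div, inv_eq_one_div,
      div_le_div_iff₀ (by positivity) (by positivity)]
    nlinarith [mul_le_mul_of_nonneg_left ht1 hS.le]

/-- Pointwise form of the local limit theorem, with an explicit constant. -/
theorem abs_sqrt_var_mul_binomProb_sub_gaussian_le {q : ℝ} (hq : 0 < q) (hq1 : q < 1) {k : ℕ}
    (hk : 1 ≤ k) (i : ℕ) :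
    |Real.sqrt ((k : ℝ) * q * (1 - q)) * binomProb k q i -
        (1 / Real.sqrt (2 * Real.pi)) *
          Real.exp (-((i : ℝ) - (k : ℝ) * q) ^ 2 / (2 * ((k : ℝ) * q * (1 - q))))| ≤
      ((Real.exp Real.pi + 1) * Real.exp 1 * (Real.pi ^ 2 / 2) ^ 2 + 4 * Real.pi) /
        (2 * Real.pi) / Real.sqrt ((k : ℝ) * q * (1 - q)) := by
  have hp : 0 < 1 - q := by linarith
  have hk0 : (0 : ℝ) < k := by exact_mod_cast hk
  have hpi : 0 < Real.pi := Real.pi_pos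
  have hbound := norm_truncated_charFun_sub_gaussian_le hq hq1 hk ((i : ℝ) - k * q)
  have hinv := intervalIntegral_centeredBernoulliCharFun_pow k q i
  have hS : 0 < (k : ℝ) * q * (1 - q) := by positivity
  have hgauss := integral_exp_mul_gaussian hS ((i : ℝ) - k * q)
  set S : ℝ := k * q * (1 - q)
  set x : ℝ := (i : ℝ) - k * q
  set F : ℝ → ℂ := fun t =>
    Complex.exp (Complex.I * (-x : ℝ) * t) * centeredBernoulliCharFun q t ^ k
  set G : ℝ → ℂ := fun t =>
    Complex.exp (Complex.I * (-x : ℝ) * t) * (Real.exp (-(S / 2 * t ^ 2)) : ℝ) with hG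
  have hc : 0 < 2 / Real.pi ^ 2 * S := by positivity
  have hFint : Integrable ((Set.Ioc (-Real.pi) Real.pi).indicator F) := by
    have hcont : Continuous F := by
      have := continuous_centeredBernoulliCharFun q
      fun_prop
    exact (integrable_indicator_iff measurableSet_Ioc).mpr
      (hcont.integrableOn_Ioc)
  have hGint : Integrable G := by
    refine (integrable_exp_neg_mul_sq (half_pos hS)).mono' (by fun_prop)
      (Filter.Eventually.of_forall fun t => ?_)
    have hphase : ‖Complex.exp (Complex.I * (-x : ℝ) * t)‖ = 1 := by
      rw [show Complex.I * ((-x : ℝ) : ℂ) * t = ((-x * t : ℝ) : ℂ) * Complex.I by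
        push_cast; ring, Complex.norm_exp_ofReal_mul_I]
    rw [hG, norm_mul, hphase, one_mul, Complex.norm_real, Real.norm_eq_abs,
      abs_of_pos (Real.exp_pos _), neg_mul]
  have hFval : ∫ t, (Set.Ioc (-Real.pi) Real.pi).indicator F t =
      2 * Real.pi * binomProb k q i := by
    rw [integral_indicator measurableSet_Ioc,
      ← intervalIntegral.integral_of_le (by linarith), hinv]
  have hdiff : ‖(2 * Real.pi * binomProb k q i : ℂ) -
      (Real.sqrt (2 * Real.pi) / Real.sqrt S * Real.exp (-x ^ 2 / (2 * S)) : ℝ)‖ ≤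
      ((Real.exp Real.pi + 1) * Real.exp 1 * (Real.pi ^ 2 / 2) ^ 2 + 4 * Real.pi) / S := by
    rw [← hFval, ← hgauss, ← integral_sub hFint hGint]
    refine (norm_integral_le_of_norm_le
      (((integrable_abs_cube_mul_exp_neg_mul_sq hc).const_mul _).add
        (integrable_inv_one_add_sq.const_mul _))
      (Filter.Eventually.of_forall hbound)).trans_eq ?_
    rw [integral_add' ((integrable_abs_cube_mul_exp_neg_mul_sq hc).const_mul _)
        (integrable_inv_one_add_sq.const_mul _), integral_const_mul, integral_const_mul,
      integral_abs_cube_mul_exp_neg_mul_sq hc, integral_univ_inv_one_add_sq]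
    field_simp
  have hcast : (2 * Real.pi * binomProb k q i : ℂ) -
      (Real.sqrt (2 * Real.pi) / Real.sqrt S * Real.exp (-x ^ 2 / (2 * S)) : ℝ) =
      ((2 * Real.pi * binomProb k q i -
        Real.sqrt (2 * Real.pi) / Real.sqrt S * Real.exp (-x ^ 2 / (2 * S)) : ℝ) : ℂ) := by
    push_cast
    ring
  rw [hcast, Complex.norm_real, Real.norm_eq_abs] at hdiff
  have hs : 0 < Real.sqrt S := Real.sqrt_pos.mpr hS
  have hr : 0 < Real.sqrt (2 * Real.pi) := Real.sqrt_pos.mpr (by positivity)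
  have hss : Real.sqrt S ^ 2 = S := Real.sq_sqrt hS.le
  have hrr : Real.sqrt (2 * Real.pi) ^ 2 = 2 * Real.pi := Real.sq_sqrt (by positivity)
  have hscale : Real.sqrt S * binomProb k q i -
      1 / Real.sqrt (2 * Real.pi) * Real.exp (-x ^ 2 / (2 * S)) =
      Real.sqrt S / (2 * Real.pi) * (2 * Real.pi * binomProb k q i -
        Real.sqrt (2 * Real.pi) / Real.sqrt S * Real.exp (-x ^ 2 / (2 * S))) := by
    have hrinv : 1 / Real.sqrt (2 * Real.pi) = Real.sqrt (2 * Real.pi) / (2 * Real.pi) := by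
      rw [div_eq_div_iff hr.ne' (by positivity), one_mul, ← sq, hrr]
    rw [hrinv]
    field_simp
  rw [hscale, abs_mul, abs_of_pos (by positivity)]
  refine (mul_le_mul_of_nonneg_left hdiff (by positivity)).trans_eq ?_
  nth_rewrite 2 [← hss]
  field_simp

/-- **Local Limit Theorem for binomials.** There is an absolute constant `γ` such that for
every positive integer `k` and every `0 < q < 1`, the random variable `X ~ Binomial(k, q)`,
which has `E[X] = kq` and `Var X = kq(1-q)`, satisfies
`sup_i |√(Var X)·P(X = i) - (1/√(2π))·exp(-(i - E X)²/(2 Var X))| < γ/√(Var X)`. -/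
theorem local_limit_binomial :
    ∃ γ : ℝ, ∀ k : ℕ, 1 ≤ k → ∀ q : ℝ, 0 < q → q < 1 →
      (⨆ i : ℕ,
        |Real.sqrt ((k : ℝ) * q * (1 - q)) * binomProb k q i -
          (1 / Real.sqrt (2 * Real.pi)) *
            Real.exp (-((i : ℝ) - (k : ℝ) * q) ^ 2 / (2 * ((k : ℝ) * q * (1 - q))))|) <
      γ / Real.sqrt ((k : ℝ) * q * (1 - q)) := by
  refine ⟨((Real.exp Real.pi + 1) * Real.exp 1 * (Real.pi ^ 2 / 2) ^ 2 + 4 * Real.pi) /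
    (2 * Real.pi) + 1, fun k hk q hq hq1 => ?_⟩
  have hp : 0 < 1 - q := by linarith
  have hk0 : (0 : ℝ) < k := by exact_mod_cast hk
  have hs : 0 < Real.sqrt ((k : ℝ) * q * (1 - q)) := Real.sqrt_pos.mpr (by positivity)
  refine (ciSup_le (abs_sqrt_var_mul_binomProb_sub_gaussian_le hq hq1 hk)).trans_lt ?_
  gcongr
  exact lt_add_one _
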